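/- arXiv:2311.01642 — 7 statements merged into one kernel-verified Lean document; each statement's English description precedes it below -/
import Mathlib

section
/- Let n ≥ 1, x : Fin n → ℝ, and τ > 0. The softmax distribution q with q i = exp (x i / τ) / ∑ j, exp (x j / τ) lies in stdSimplex ℝ (Fin n) and attains the soft value exactly: ∑ i, q i * x i + τ * H(q) = τ * Real.log (∑ i, Real.exp (x i / τ)). -/
open Finset Real

/-- Shannon entropy of a finite probability vector (with the convention `0 * log 0 = 0`). -/
noncomputable def shannonEntropy {n : ℕ} (p : Fin n → ℝ) : ℝ :=
  -∑ i, p i * Real.log (p i)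

theorem softmax_mem_stdSimplex {ι : Type*} [Fintype ι] [Nonempty ι] (y : ι → ℝ) :
    (fun i => Real.exp (y i) / ∑ j, Real.exp (y j)) ∈ stdSimplex ℝ ι := by
  have hZ : 0 < ∑ j, Real.exp (y j) :=
    Finset.sum_pos (fun j _ => Real.exp_pos _) Finset.univ_nonempty
  refine ⟨fun i => by positivity, ?_⟩
  rw [← Finset.sum_div, div_self hZ.ne']

theorem softmax_mem_stdSimplex_and_attains_soft_value
    (n : ℕ) (hn : 1 ≤ n) (x : Fin n → ℝ) (τ : ℝ) (hτ : 0 < τ) :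
    (fun i => Real.exp (x i / τ) / ∑ j, Real.exp (x j / τ)) ∈ stdSimplex ℝ (Fin n) ∧
    ∑ i, (Real.exp (x i / τ) / ∑ j, Real.exp (x j / τ)) * x i
        + τ * shannonEntropy (fun i => Real.exp (x i / τ) / ∑ j, Real.exp (x j / τ))
      = τ * Real.log (∑ i, Real.exp (x i / τ)) := by
  have : Nonempty (Fin n) := ⟨⟨0, hn⟩⟩
  have hq := softmax_mem_stdSimplex fun i => x i / τ
  refine ⟨hq, ?_⟩
  have hZ : 0 < ∑ j, Real.exp (x j / τ) :=
    Finset.sum_pos (fun j _ => Real.exp_pos _) Finset.univ_nonempty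
  have hsum := hq.2
  set Z := ∑ j, Real.exp (x j / τ)
  have hlog (i : Fin n) : Real.log (Real.exp (x i / τ) / Z) = x i / τ - Real.log Z := by
    rw [Real.log_div (Real.exp_ne_zero _) hZ.ne', Real.log_exp]
  calc
    _ = ∑ i, Real.exp (x i / τ) / Z * (τ * Real.log Z) := by
      simp only [shannonEntropy, hlog]
      rw [mul_neg, ← sub_eq_add_neg, Finset.mul_sum, ← Finset.sum_sub_distrib]
      refine Finset.sum_congr rfl fun i _ => ?_
      field_simp
      ring
    _ = τ * Real.log Z := by rw [← Finset.sum_mul, hsum, one_mul]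
end

section
/- Let n ≥ 1, x : Fin n → ℝ, and τ > 0. If p ∈ stdSimplex ℝ (Fin n) satisfies ∑ i, p i * x i + τ * H(p) = τ * Real.log (∑ i, Real.exp (x i / τ)), then p equals the softmax distribution: p i = exp (x i / τ) / ∑ j, exp (x j / τ) for every i. In particular the softmax distribution is the unique maximizer of p ↦ ∑ i, p i * x i + τ * H(p) over the simplex. -/
open Finset Real

/-- Equality case of Gibbs' inequality: a nonnegative vector whose relative entropy with respect
to a positive vector of the same total mass vanishes is equal to that vector. -/
theorem eq_of_sum_mul_log_sub_log_eq_zero {ι : Type*} [Fintype ι] {p q : ι → ℝ}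
    (hp : ∀ i, 0 ≤ p i) (hq : ∀ i, 0 < q i) (hpq : ∑ i, p i = ∑ i, q i)
    (h : ∑ i, p i * (Real.log (p i) - Real.log (q i)) = 0) : p = q := by
  have hterm : ∀ i, q i * InformationTheory.klFun (p i / q i)
      = p i * (Real.log (p i) - Real.log (q i)) + q i - p i := by
    intro i
    have hqi := (hq i).ne'
    rcases (hp i).eq_or_lt with h0 | hpos
    · simp [← h0, InformationTheory.klFun]
    · rw [InformationTheory.klFun, Real.log_div hpos.ne' hqi]
      field_simp
  have hsum : ∑ i, q i * InformationTheory.klFun (p i / q i) = 0 := by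
    simp only [hterm, sum_sub_distrib, sum_add_distrib, h, hpq]
    ring
  have hnonneg : ∀ i ∈ univ, 0 ≤ q i * InformationTheory.klFun (p i / q i) := fun i _ =>
    mul_nonneg (hq i).le (InformationTheory.klFun_nonneg (div_nonneg (hp i) (hq i).le))
  funext i
  have hi := (sum_eq_zero_iff_of_nonneg hnonneg).1 hsum i (mem_univ i)
  have hkl := (mul_eq_zero.1 hi).resolve_left (hq i).ne'
  rw [InformationTheory.klFun_eq_zero_iff (div_nonneg (hp i) (hq i).le)] at hkl
  exact (div_eq_one_iff_eq (hq i).ne').1 hkl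

theorem softmax_unique_maximizer
    (n : ℕ) (hn : 1 ≤ n) (x : Fin n → ℝ) (τ : ℝ) (hτ : 0 < τ)
    (p : Fin n → ℝ) (hp : p ∈ stdSimplex ℝ (Fin n))
    (heq : ∑ i, p i * x i + τ * shannonEntropy p
      = τ * Real.log (∑ i, Real.exp (x i / τ))) :
    ∀ i, p i = Real.exp (x i / τ) / ∑ j, Real.exp (x j / τ) := by
  obtain ⟨hp0, hp1⟩ := hp
  have hZ : 0 < ∑ j, Real.exp (x j / τ) :=
    sum_pos (fun j _ => Real.exp_pos _) ⟨⟨0, hn⟩, mem_univ _⟩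
  refine congrFun (eq_of_sum_mul_log_sub_log_eq_zero hp0
    (fun i => div_pos (Real.exp_pos (x i / τ)) hZ) ?_ ?_)
  · rw [hp1, ← sum_div, div_self hZ.ne']
  · set L := Real.log (∑ j, Real.exp (x j / τ)) with hL
    have hlog : ∀ i, Real.log (Real.exp (x i / τ) / ∑ j, Real.exp (x j / τ)) = x i / τ - L :=
      fun i => by rw [Real.log_div (Real.exp_pos _).ne' hZ.ne', Real.log_exp]
    have hterm : ∀ i, p i * (Real.log (p i) - (x i / τ - L))
        = p i * Real.log (p i) - p i * x i / τ + p i * L := fun i => by ring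
    simp only [hlog, hterm, sum_add_distrib, sum_sub_distrib, ← sum_div, ← sum_mul, hp1]
    rw [shannonEntropy] at heq
    field_simp
    linarith
end

section
/- Let n ≥ 1 and x : Fin n → ℝ. The soft value is monotone nondecreasing in the temperature: for all 0 < τ₁ ≤ τ₂, τ₁ * Real.log (∑ i, Real.exp (x i / τ₁)) ≤ τ₂ * Real.log (∑ i, Real.exp (x i / τ₂)). -/
open Finset Real

theorem soft_value_monotone_in_temperature
    (n : ℕ) (hn : 1 ≤ n) (x : Fin n → ℝ) (τ₁ τ₂ : ℝ) (hτ₁ : 0 < τ₁) (h : τ₁ ≤ τ₂) :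
    τ₁ * Real.log (∑ i, Real.exp (x i / τ₁))
      ≤ τ₂ * Real.log (∑ i, Real.exp (x i / τ₂)) := by
  have : Nonempty (Fin n) := ⟨⟨0, hn⟩⟩
  have hτ₂ : 0 < τ₂ := hτ₁.trans_le h
  have sum_exp_pos (τ : ℝ) : 0 < ∑ i, exp (x i / τ) :=
    Finset.sum_pos (fun i _ => exp_pos _) univ_nonempty
  set L := Real.log (∑ i, exp (x i / τ₂))
  have exp_L : exp L = ∑ i, exp (x i / τ₂) := exp_log (sum_exp_pos τ₂)
  have le_L (i : Fin n) : x i / τ₂ ≤ L := by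
    rw [← exp_le_exp, exp_L]
    exact Finset.single_le_sum (f := fun j => exp (x j / τ₂))
      (fun j _ => (exp_pos _).le) (mem_univ i)
  have hp : 0 ≤ τ₂ / τ₁ - 1 := sub_nonneg.2 ((one_le_div hτ₁).2 h)
  have exponent_le (i : Fin n) : x i / τ₁ ≤ x i / τ₂ + (τ₂ / τ₁ - 1) * L := by
    have split : x i / τ₁ = x i / τ₂ + (τ₂ / τ₁ - 1) * (x i / τ₂) := by
      field_simp
      ring
    rw [split]
    gcongr
    exact le_L i
  have sum_le : ∑ i, exp (x i / τ₁) ≤ exp (τ₂ / τ₁ * L) :=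
    calc ∑ i, exp (x i / τ₁)
        ≤ ∑ i, exp (x i / τ₂) * exp ((τ₂ / τ₁ - 1) * L) := by
          gcongr with i
          rw [← exp_add]
          exact exp_le_exp.2 (exponent_le i)
      _ = exp (τ₂ / τ₁ * L) := by
          rw [← Finset.sum_mul, ← exp_L, ← exp_add]
          ring_nf
  calc τ₁ * Real.log (∑ i, exp (x i / τ₁))
      ≤ τ₁ * (τ₂ / τ₁ * L) := by
        gcongr
        exact (log_le_iff_le_exp (sum_exp_pos τ₁)).2 sum_le
    _ = τ₂ * L := by field_simp
end

section
/- Let m, n ≥ 1, X : Matrix (Fin m) (Fin n) ℝ a payoff matrix, and β, α > 0 temperatures. There exists a logit quantal response equilibrium: a pair μ ∈ stdSimplex ℝ (Fin m), ν ∈ stdSimplex ℝ (Fin n) such that for all i, μ i = Real.exp ((∑ j, X i j * ν j) / β) / ∑ i', Real.exp ((∑ j, X i' j * ν j) / β), and for all j, ν j = Real.exp (−(∑ i, μ i * X i j) / α) / ∑ j', Real.exp (−(∑ i, μ i * X i j') / α). -/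
open Finset Real

section QuantalResponse

variable {ι κ : Type*} [Fintype ι] [Fintype κ]

/-- The Boltzmann distribution with weights `exp (u i)`. -/
noncomputable def boltzmann (u : ι → ℝ) (i : ι) : ℝ :=
  exp (u i) / ∑ i', exp (u i')

lemma sum_exp_pos [Nonempty ι] (u : ι → ℝ) : 0 < ∑ i, exp (u i) :=
  Finset.sum_pos (fun i _ => exp_pos (u i)) Finset.univ_nonempty

lemma boltzmann_pos [Nonempty ι] (u : ι → ℝ) (i : ι) : 0 < boltzmann u i :=
  div_pos (exp_pos _) (sum_exp_pos u)

lemma boltzmann_mem_stdSimplex [Nonempty ι] (u : ι → ℝ) :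
    boltzmann u ∈ stdSimplex ℝ ι := by
  refine ⟨fun i => (boltzmann_pos u i).le, ?_⟩
  simp only [boltzmann, ← Finset.sum_div]
  exact div_self (sum_exp_pos u).ne'

lemma log_boltzmann [Nonempty ι] (u : ι → ℝ) (i : ι) :
    log (boltzmann u i) = u i - log (∑ i', exp (u i')) := by
  rw [boltzmann, log_div (exp_pos _).ne' (sum_exp_pos u).ne', log_exp]

lemma sub_lt_mul_log_sub_mul_log {x s : ℝ} (hx : 0 ≤ x) (hs : 0 < s) (hne : x ≠ s) :
    x - s < x * log x - x * log s := by
  rcases hx.eq_or_lt with rfl | hx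
  · simpa using hs
  · have h := log_lt_sub_one_of_pos (div_pos hs hx)
      (by rw [ne_eq, div_eq_one_iff_eq hx.ne']; exact hne.symm)
    rw [log_div hs.ne' hx.ne'] at h
    have h' := mul_lt_mul_of_pos_left h hx
    have e : x * (s / x - 1) = s - x := by field_simp
    rw [e] at h'
    linarith

/-- Gibbs' inequality, with its equality case. -/
lemma eq_of_sum_mul_log_le {p q : ι → ℝ} (hp : p ∈ stdSimplex ℝ ι)
    (hq : q ∈ stdSimplex ℝ ι) (hq0 : ∀ i, 0 < q i)
    (h : ∑ i, p i * log (p i) ≤ ∑ i, p i * log (q i)) : p = q := by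
  by_contra hne
  obtain ⟨k, hk⟩ := Function.ne_iff.mp hne
  have hlt : ∑ i, (p i - q i) < ∑ i, (p i * log (p i) - p i * log (q i)) := by
    refine Finset.sum_lt_sum (fun i _ => ?_)
      ⟨k, mem_univ k, sub_lt_mul_log_sub_mul_log (hp.1 k) (hq0 k) hk⟩
    by_cases hi : p i = q i
    · simp [hi]
    · exact (sub_lt_mul_log_sub_mul_log (hp.1 i) (hq0 i) hi).le
  rw [sum_sub_distrib, sum_sub_distrib, hp.2, hq.2] at hlt
  linarith

/-- The Boltzmann distribution is the unique maximizer of entropy-regularized utility. -/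
lemma eq_boltzmann_of_le [Nonempty ι] (u : ι → ℝ) {p : ι → ℝ} (hp : p ∈ stdSimplex ℝ ι)
    (h : ∑ i, boltzmann u i * u i - ∑ i, boltzmann u i * log (boltzmann u i)
      ≤ ∑ i, p i * u i - ∑ i, p i * log (p i)) : p = boltzmann u := by
  have key : ∀ r ∈ stdSimplex ℝ ι, ∑ i, r i * log (boltzmann u i)
      = ∑ i, r i * u i - log (∑ i, exp (u i)) := fun r hr => by
    simp only [log_boltzmann, mul_sub, sum_sub_distrib, ← Finset.sum_mul, hr.2, one_mul]
  have hσ := boltzmann_mem_stdSimplex u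
  refine eq_of_sum_mul_log_le hp hσ (boltzmann_pos u) ?_
  rw [key _ hp]
  rw [key _ hσ] at h
  linarith

lemma hasDerivAt_log_sum_exp_line [Nonempty ι] (a b : ι → ℝ) :
    HasDerivAt (fun t : ℝ => log (∑ i, exp (a i + t * b i)))
      (∑ i, boltzmann a i * b i) 0 := by
  have h1 : ∀ i ∈ (univ : Finset ι), HasDerivAt (fun t : ℝ => exp (a i + t * b i))
      (exp (a i) * b i) 0 := fun i _ => by
    simpa using (((hasDerivAt_id (0 : ℝ)).mul_const (b i)).const_add (a i)).exp
  have h2 := (HasDerivAt.fun_sum h1).log (by simpa using (sum_exp_pos a).ne')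
  convert h2 using 1
  simp [boltzmann, Finset.sum_div, div_mul_eq_mul_div]

lemma HasDerivAt.nonneg_of_le_right {f : ℝ → ℝ} {d : ℝ} (hf : HasDerivAt f d 0)
    (h : ∀ t ∈ Set.Ioc (0 : ℝ) 1, f 0 ≤ f t) : 0 ≤ d := by
  refine ge_of_tendsto hf.tendsto_slope_zero_right ?_
  filter_upwards [Ioc_mem_nhdsGT (zero_lt_one (α := ℝ))] with t ht
  have := h t ht
  simp only [zero_add, smul_eq_mul]
  exact mul_nonneg (inv_nonneg.mpr ht.1.le) (by linarith)

/-- A minimizer over the simplex of the log-sum-exp of the row payoffs, regularized by entropy,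
is the Boltzmann response to the Boltzmann response to itself. -/
lemma exists_eq_boltzmann_boltzmann [Nonempty ι] [Nonempty κ] (X : Matrix ι κ ℝ)
    {α β : ℝ} (hα : 0 < α) (hβ : 0 < β) :
    ∃ ν ∈ stdSimplex ℝ κ, ν = boltzmann fun j =>
      -(∑ i, boltzmann (fun i' => (∑ j', X i' j' * ν j') / β) i * X i j) / α := by
  classical
  let G : (κ → ℝ) → ℝ := fun ν =>
    β * log (∑ i, exp ((∑ j, X i j * ν j) / β)) + α * ∑ j, ν j * log (ν j)
  have hG : Continuous G := by
    refine (continuous_const.mul (Continuous.log (by fun_prop)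
      fun ν => (sum_exp_pos _).ne')).add (continuous_const.mul ?_)
    exact continuous_finsetSum _ fun j _ => continuous_mul_log.comp (continuous_apply j)
  obtain ⟨ν, hν, hmin⟩ := (isCompact_stdSimplex ℝ κ).exists_isMinOn
    ⟨_, boltzmann_mem_stdSimplex (0 : κ → ℝ)⟩ hG.continuousOn
  refine ⟨ν, hν, ?_⟩
  set a : ι → ℝ := fun i => (∑ j, X i j * ν j) / β with ha
  set u : κ → ℝ := fun j => -(∑ i, boltzmann a i * X i j) / α with hu
  set σ := boltzmann u with hσdef
  have hσ : σ ∈ stdSimplex ℝ κ := boltzmann_mem_stdSimplex u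
  let b : ι → ℝ := fun i => (∑ j, X i j * (σ j - ν j)) / β
  let hE : (κ → ℝ) → ℝ := fun p => ∑ j, p j * log (p j)
  have hderiv : HasDerivAt
      (fun t : ℝ => β * log (∑ i, exp (a i + t * b i)) + α * (hE ν + t * (hE σ - hE ν)))
      (β * (∑ i, boltzmann a i * b i) + α * (hE σ - hE ν)) 0 := by
    refine ((hasDerivAt_log_sum_exp_line a b).const_mul β).add (HasDerivAt.const_mul α ?_)
    simpa using ((hasDerivAt_id (0 : ℝ)).mul_const (hE σ - hE ν)).const_add (hE ν)
  have hnonneg := hderiv.nonneg_of_le_right fun t ht => by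
    let p : κ → ℝ := (1 - t) • ν + t • σ
    have hp : p ∈ stdSimplex ℝ κ :=
      convex_stdSimplex ℝ κ hν hσ (by linarith [ht.2]) ht.1.le (by ring)
    have hmp : G ν ≤ G p := hmin hp
    have hlin : ∀ i, (∑ j, X i j * p j) / β = a i + t * b i := fun i => by
      simp only [ha, b, ← mul_div_assoc, ← add_div, Finset.mul_sum, ← Finset.sum_add_distrib]
      congr 1
      refine Finset.sum_congr rfl fun j _ => ?_
      simp only [p, Pi.add_apply, Pi.smul_apply, smul_eq_mul]
      ring
    have hconv : hE p ≤ hE ν + t * (hE σ - hE ν) := by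
      have : hE ν + t * (hE σ - hE ν)
          = ∑ j, ((1 - t) * (ν j * log (ν j)) + t * (σ j * log (σ j))) := by
        rw [Finset.sum_add_distrib, ← Finset.mul_sum, ← Finset.mul_sum]
        simp only [hE]
        ring
      rw [this]
      refine Finset.sum_le_sum fun j _ => ?_
      simpa [p] using convexOn_mul_log.2 (hν.1 j) (hσ.1 j)
        (by linarith [ht.2] : 0 ≤ 1 - t) ht.1.le (by ring)
    have hGp : G p = β * log (∑ i, exp (a i + t * b i)) + α * hE p := by
      simp only [G, hlin, hE]
    have := mul_le_mul_of_nonneg_left hconv hα.le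
    simp only [zero_mul, add_zero]
    change G ν ≤ _
    linarith
  have hb : β * (∑ i, boltzmann a i * b i)
      = α * (∑ j, ν j * u j - ∑ j, σ j * u j) := by
    rw [← Finset.sum_sub_distrib, Finset.mul_sum, Finset.mul_sum]
    have h1 : ∀ i, β * (boltzmann a i * b i)
        = ∑ j, boltzmann a i * X i j * (σ j - ν j) := fun i => by
      simp only [b, mul_assoc, ← Finset.mul_sum]
      field_simp
    have h2 : ∀ j, α * (ν j * u j - σ j * u j)
        = ∑ i, boltzmann a i * X i j * (σ j - ν j) := fun j => by
      rw [← Finset.sum_mul]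
      simp only [hu]
      field_simp
      ring
    simp only [h1, h2]
    exact Finset.sum_comm
  rw [hb, ← mul_add] at hnonneg
  have := nonneg_of_mul_nonneg_right hnonneg hα
  refine eq_boltzmann_of_le u hν ?_
  simp only [hE, hσdef] at this
  linarith

end QuantalResponse

theorem exists_logit_quantal_response_equilibrium
    (m n : ℕ) (hm : 1 ≤ m) (hn : 1 ≤ n) (X : Matrix (Fin m) (Fin n) ℝ)
    (β α : ℝ) (hβ : 0 < β) (hα : 0 < α) :
    ∃ (μ : Fin m → ℝ) (ν : Fin n → ℝ),
      μ ∈ stdSimplex ℝ (Fin m) ∧ ν ∈ stdSimplex ℝ (Fin n) ∧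
      (∀ i, μ i = Real.exp ((∑ j, X i j * ν j) / β)
          / ∑ i', Real.exp ((∑ j, X i' j * ν j) / β)) ∧
      (∀ j, ν j = Real.exp (-(∑ i, μ i * X i j) / α)
          / ∑ j', Real.exp (-(∑ i, μ i * X i j') / α)) := by
  have : Nonempty (Fin m) := ⟨⟨0, hm⟩⟩
  have : Nonempty (Fin n) := ⟨⟨0, hn⟩⟩
  obtain ⟨ν, hν, h⟩ := exists_eq_boltzmann_boltzmann X hα hβ
  exact ⟨_, ν, boltzmann_mem_stdSimplex _, hν, fun _ => rfl, fun j => congrFun h j⟩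
end

section
/- Let m, n ≥ 1, X : Matrix (Fin m) (Fin n) ℝ, and β, α > 0, and let F(μ, ν) = ∑ i, ∑ j, μ i * X i j * ν j + β * H(μ) − α * H(ν). Then F admits a saddle point: there exist μ* ∈ stdSimplex ℝ (Fin m) and ν* ∈ stdSimplex ℝ (Fin n) such that F(μ, ν*) ≤ F(μ*, ν*) ≤ F(μ*, ν) for all μ ∈ stdSimplex ℝ (Fin m) and ν ∈ stdSimplex ℝ (Fin n). -/
open Finset Real

/-- Entropy-regularized zero-sum game objective
`F(μ, ν) = ∑ i, ∑ j, μ i * X i j * ν j + β * H(μ) - α * H(ν)`. -/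
noncomputable def entRegObj {m n : ℕ} (X : Matrix (Fin m) (Fin n) ℝ) (β α : ℝ)
    (μ : Fin m → ℝ) (ν : Fin n → ℝ) : ℝ :=
  (∑ i, ∑ j, μ i * X i j * ν j) + β * shannonEntropy μ - α * shannonEntropy ν

theorem concaveOn_shannonEntropy (n : ℕ) :
    ConcaveOn ℝ (stdSimplex ℝ (Fin n)) shannonEntropy := by
  refine ⟨convex_stdSimplex ℝ _, fun p hp q hq a b ha hb hab => ?_⟩
  simp only [shannonEntropy, smul_eq_mul, mul_neg, Finset.mul_sum, ← Finset.sum_neg_distrib,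
    ← Finset.sum_add_distrib]
  refine Finset.sum_le_sum fun i _ => ?_
  have h := convexOn_mul_log.2 (hp.1 i) (hq.1 i) ha hb hab
  simp only [smul_eq_mul] at h
  simp only [Pi.add_apply, Pi.smul_apply, smul_eq_mul]
  linarith

theorem continuous_shannonEntropy (n : ℕ) :
    Continuous (shannonEntropy : (Fin n → ℝ) → ℝ) :=
  (continuous_finsetSum _ fun i _ => (continuous_apply i).mul_log).neg

theorem continuous_entRegObj_left {m n : ℕ} (X : Matrix (Fin m) (Fin n) ℝ) (β α : ℝ)
    (ν : Fin n → ℝ) : Continuous fun μ => entRegObj X β α μ ν := by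
  have := continuous_shannonEntropy m
  unfold entRegObj
  fun_prop

theorem continuous_entRegObj_right {m n : ℕ} (X : Matrix (Fin m) (Fin n) ℝ) (β α : ℝ)
    (μ : Fin m → ℝ) : Continuous fun ν => entRegObj X β α μ ν := by
  have := continuous_shannonEntropy n
  unfold entRegObj
  fun_prop

theorem entRegObj_eq_toLinearMap₂' {m n : ℕ} (X : Matrix (Fin m) (Fin n) ℝ) (β α : ℝ)
    (μ : Fin m → ℝ) (ν : Fin n → ℝ) :
    entRegObj X β α μ ν =
      Matrix.toLinearMap₂' ℝ X μ ν + β * shannonEntropy μ - α * shannonEntropy ν := by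
  simp only [entRegObj, Matrix.toLinearMap₂'_apply, smul_eq_mul]
  refine congrArg (fun t => t + _ - _)
    (Finset.sum_congr rfl fun i _ => Finset.sum_congr rfl fun j _ => ?_)
  ring

theorem concaveOn_entRegObj_left {m n : ℕ} (X : Matrix (Fin m) (Fin n) ℝ) {β : ℝ} (hβ : 0 ≤ β)
    (α : ℝ) (ν : Fin n → ℝ) :
    ConcaveOn ℝ (stdSimplex ℝ (Fin m)) fun μ => entRegObj X β α μ ν := by
  simp only [entRegObj_eq_toLinearMap₂', sub_eq_add_neg]
  exact ((((Matrix.toLinearMap₂' ℝ X).flip ν).concaveOn (convex_stdSimplex ℝ _)).add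
    ((concaveOn_shannonEntropy m).smul hβ)).add_const _

theorem convexOn_entRegObj_right {m n : ℕ} (X : Matrix (Fin m) (Fin n) ℝ) (β : ℝ) {α : ℝ}
    (hα : 0 ≤ α) (μ : Fin m → ℝ) :
    ConvexOn ℝ (stdSimplex ℝ (Fin n)) fun ν => entRegObj X β α μ ν := by
  simp only [entRegObj_eq_toLinearMap₂']
  exact (((Matrix.toLinearMap₂' ℝ X μ).convexOn (convex_stdSimplex ℝ _)).add_const _).sub
    ((concaveOn_shannonEntropy n).smul hα)

theorem exists_saddle_point_of_entropy_regularized_game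
    (m n : ℕ) (hm : 1 ≤ m) (hn : 1 ≤ n) (X : Matrix (Fin m) (Fin n) ℝ)
    (β α : ℝ) (hβ : 0 < β) (hα : 0 < α) :
    ∃ μs ∈ stdSimplex ℝ (Fin m), ∃ νs ∈ stdSimplex ℝ (Fin n),
      (∀ μ ∈ stdSimplex ℝ (Fin m), entRegObj X β α μ νs ≤ entRegObj X β α μs νs) ∧
      (∀ ν ∈ stdSimplex ℝ (Fin n), entRegObj X β α μs νs ≤ entRegObj X β α μs ν) := by
  have : NeZero m := ⟨by lia⟩
  have : NeZero n := ⟨by lia⟩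
  obtain ⟨νs, hνs, μs, hμs, hs⟩ := Sion.exists_isSaddlePointOn
    (X := stdSimplex ℝ (Fin n)) (Y := stdSimplex ℝ (Fin m))
    (f := fun ν μ => entRegObj X β α μ ν)
    ⟨_, single_mem_stdSimplex ℝ 0⟩ (convex_stdSimplex ℝ _) (isCompact_stdSimplex ℝ _)
    (fun μ _ => (continuous_entRegObj_right X β α μ).lowerSemicontinuous.lowerSemicontinuousOn _)
    (fun μ _ => (convexOn_entRegObj_right X β hα.le μ).quasiconvexOn)
    (convex_stdSimplex ℝ _) ⟨_, single_mem_stdSimplex ℝ 0⟩ (isCompact_stdSimplex ℝ _)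
    (fun ν _ => (continuous_entRegObj_left X β α ν).upperSemicontinuous.upperSemicontinuousOn _)
    (fun ν _ => (concaveOn_entRegObj_left X hβ.le α ν).quasiconcaveOn)
  exact ⟨μs, hμs, νs, hνs, fun μ hμ => hs νs hνs μ hμ, fun ν hν => hs ν hν μs hμs⟩
end

section
/- Let m, n ≥ 1, X : Matrix (Fin m) (Fin n) ℝ, and β, α > 0, and let F(μ, ν) = ∑ i, ∑ j, μ i * X i j * ν j + β * H(μ) − α * H(ν). The saddle point of F is unique: if (μ₁, ν₁) and (μ₂, ν₂) in stdSimplex ℝ (Fin m) × stdSimplex ℝ (Fin n) both satisfy F(μ, νₖ) ≤ F(μₖ, νₖ) ≤ F(μₖ, ν) for all μ, ν in the respective simplices (k = 1, 2), then μ₁ = μ₂ and ν₁ = ν₂. -/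
open Finset Real

lemma strictConcaveOn_shannonEntropy (n : ℕ) :
    StrictConcaveOn ℝ (stdSimplex ℝ (Fin n)) (shannonEntropy (n := n)) := by
  have hsum : ∀ p : Fin n → ℝ, shannonEntropy p = ∑ i, negMulLog (p i) := fun p => by
    simp [shannonEntropy, negMulLog]
  refine ⟨convex_stdSimplex ℝ _, fun p hp q hq hpq a b ha hb hab => ?_⟩
  obtain ⟨k, hk⟩ := Function.ne_iff.mp hpq
  simp only [hsum, Finset.smul_sum, ← Finset.sum_add_distrib]
  exact Finset.sum_lt_sum
    (fun i _ => concaveOn_negMulLog.2 (hp.1 i) (hq.1 i) ha.le hb.le hab)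
    ⟨k, Finset.mem_univ k, strictConcaveOn_negMulLog.2 (hp.1 k) (hq.1 k) hk ha hb hab⟩

lemma strictConcaveOn_entRegObj_left {m n : ℕ} (X : Matrix (Fin m) (Fin n) ℝ) {β : ℝ} (α : ℝ)
    (hβ : 0 < β) (ν : Fin n → ℝ) :
    StrictConcaveOn ℝ (stdSimplex ℝ (Fin m)) (fun μ => entRegObj X β α μ ν) := by
  refine ⟨convex_stdSimplex ℝ _, fun p hp q hq hpq a b ha hb hab => ?_⟩
  have hent := mul_lt_mul_of_pos_left
    ((strictConcaveOn_shannonEntropy m).2 hp hq hpq ha hb hab) hβ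
  have hlin : ∑ i, ∑ j, (a • p + b • q) i * X i j * ν j =
      a * ∑ i, ∑ j, p i * X i j * ν j + b * ∑ i, ∑ j, q i * X i j * ν j := by
    simp only [Finset.mul_sum, ← Finset.sum_add_distrib, Pi.add_apply, Pi.smul_apply, smul_eq_mul]
    exact Finset.sum_congr rfl fun i _ => Finset.sum_congr rfl fun j _ => by ring
  simp only [entRegObj, smul_eq_mul, hlin] at hent ⊢
  linear_combination hent - α * shannonEntropy ν * hab

/-- Exchanging the roles of the two players negates the objective. -/
lemma entRegObj_neg_transpose {m n : ℕ} (X : Matrix (Fin m) (Fin n) ℝ) (β α : ℝ)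
    (μ : Fin m → ℝ) (ν : Fin n → ℝ) :
    entRegObj (-X.transpose) α β ν μ = -entRegObj X β α μ ν := by
  have hlin : ∑ j, ∑ i, ν j * (-X.transpose) j i * μ i = -∑ i, ∑ j, μ i * X i j * ν j := by
    rw [Finset.sum_comm]
    simp only [← Finset.sum_neg_distrib, Matrix.neg_apply, Matrix.transpose_apply]
    exact Finset.sum_congr rfl fun i _ => Finset.sum_congr rfl fun j _ => by ring
  rw [entRegObj, entRegObj, hlin]
  ring

lemma strictConvexOn_entRegObj_right {m n : ℕ} (X : Matrix (Fin m) (Fin n) ℝ) (β : ℝ) {α : ℝ}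
    (hα : 0 < α) (μ : Fin m → ℝ) :
    StrictConvexOn ℝ (stdSimplex ℝ (Fin n)) (fun ν => entRegObj X β α μ ν) := by
  have h := (strictConcaveOn_entRegObj_left (-X.transpose) β hα μ).neg
  simpa [Pi.neg_def, entRegObj_neg_transpose] using h

theorem saddle_point_unique_of_entropy_regularized_game
    (m n : ℕ) (hm : 1 ≤ m) (hn : 1 ≤ n) (X : Matrix (Fin m) (Fin n) ℝ)
    (β α : ℝ) (hβ : 0 < β) (hα : 0 < α)
    (μ₁ μ₂ : Fin m → ℝ) (ν₁ ν₂ : Fin n → ℝ)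
    (hμ₁ : μ₁ ∈ stdSimplex ℝ (Fin m)) (hν₁ : ν₁ ∈ stdSimplex ℝ (Fin n))
    (hμ₂ : μ₂ ∈ stdSimplex ℝ (Fin m)) (hν₂ : ν₂ ∈ stdSimplex ℝ (Fin n))
    (h₁ : (∀ μ ∈ stdSimplex ℝ (Fin m), entRegObj X β α μ ν₁ ≤ entRegObj X β α μ₁ ν₁) ∧
          (∀ ν ∈ stdSimplex ℝ (Fin n), entRegObj X β α μ₁ ν₁ ≤ entRegObj X β α μ₁ ν))
    (h₂ : (∀ μ ∈ stdSimplex ℝ (Fin m), entRegObj X β α μ ν₂ ≤ entRegObj X β α μ₂ ν₂) ∧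
          (∀ ν ∈ stdSimplex ℝ (Fin n), entRegObj X β α μ₂ ν₂ ≤ entRegObj X β α μ₂ ν)) :
    μ₁ = μ₂ ∧ ν₁ = ν₂ := by
  have h₁₂ := h₁.2 ν₂ hν₂
  have h₂₂ := h₂.1 μ₁ hμ₁
  have h₂₁ := h₂.2 ν₁ hν₁
  have h₁₁ := h₁.1 μ₂ hμ₂
  constructor
  · exact (strictConcaveOn_entRegObj_left X α hβ ν₁).eq_of_isMaxOn h₁.1
      (fun μ hμ => (h₁.1 μ hμ).trans (by linarith)) hμ₁ hμ₂
  · exact (strictConvexOn_entRegObj_right X β hα μ₁).eq_of_isMinOn h₁.2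
      (fun ν hν => le_trans (by linarith) (h₁.2 ν hν)) hν₁ hν₂
end

section
/- Let a₁, a₂, r₁, r₂ > 0. The Kullback–Leibler divergence between the Gamma distribution with shape a₁ and rate r₁ and the Gamma distribution with shape a₂ and rate r₂ admits the closed form: klDiv (gammaMeasure a₁ r₁) (gammaMeasure a₂ r₂) = ENNReal.ofReal ((a₁ − a₂) * (deriv (fun x => Real.log (Real.Gamma x)) a₁) − Real.log (Real.Gamma a₁) + Real.log (Real.Gamma a₂) + a₂ * (Real.log r₁ − Real.log r₂) + a₁ * (r₂ − r₁) / r₁). -/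
open MeasureTheory ProbabilityTheory Real Classical

/-- Kullback–Leibler divergence between two measures: the integral of the
log-likelihood ratio when `μ ≪ ν` and the ratio is integrable, `∞` otherwise. -/
noncomputable def klDiv (μ ν : Measure ℝ) : ENNReal :=
  if μ ≪ ν ∧ Integrable (llr μ ν) μ then ENNReal.ofReal (∫ x, llr μ ν x ∂μ) else ⊤

lemma measurable_gammaPDF (a r : ℝ) : Measurable (gammaPDF a r) :=
  (measurable_gammaPDFReal a r).ennreal_ofReal

lemma toReal_gammaPDF {a r : ℝ} (ha : 0 < a) (hr : 0 < r) (x : ℝ) :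
    (gammaPDF a r x).toReal = gammaPDFReal a r x :=
  ENNReal.toReal_ofReal (gammaPDFReal_nonneg ha hr x)

lemma integrable_gammaPDFReal {a r : ℝ} (ha : 0 < a) (hr : 0 < r) :
    Integrable (gammaPDFReal a r) := by
  have h := integrable_toReal_of_lintegral_ne_top (measurable_gammaPDF a r).aemeasurable
    (by simp [lintegral_gammaPDF_eq_one ha hr] : ∫⁻ x, gammaPDF a r x ≠ ⊤)
  simpa only [toReal_gammaPDF ha hr] using h

lemma integral_gammaPDFReal {a r : ℝ} (ha : 0 < a) (hr : 0 < r) :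
    ∫ x, gammaPDFReal a r x = 1 := by
  simp_rw [← toReal_gammaPDF ha hr]
  rw [integral_toReal (measurable_gammaPDF a r).aemeasurable
    (.of_forall fun _ ↦ ENNReal.ofReal_lt_top), lintegral_gammaPDF_eq_one ha hr,
    ENNReal.toReal_one]

lemma ae_pos_gammaMeasure (a r : ℝ) : ∀ᵐ x ∂gammaMeasure a r, 0 < x := by
  rw [gammaMeasure, ae_withDensity_iff (measurable_gammaPDF a r)]
  filter_upwards [Measure.ae_ne volume (0 : ℝ)] with x hx h
  contrapose! h
  exact gammaPDF_of_neg (lt_of_le_of_ne h hx)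

/-- Multiplying a Gamma density by `x ^ t` gives a multiple of the Gamma density whose shape is
shifted by `t`. -/
lemma gammaPDFReal_mul_exp_mul_log {a r t : ℝ} (ha : 0 < a) (hr : 0 < r) (hat : 0 < a + t)
    {x : ℝ} (hx : x ≠ 0) :
    gammaPDFReal a r x * exp (t * log x)
      = Gamma (a + t) / (Gamma a * r ^ t) * gammaPDFReal (a + t) r x := by
  rcases lt_or_gt_of_ne hx with hx | hx
  · simp [gammaPDFReal, hx.not_ge]
  · have h₁ := (Gamma_pos_of_pos hat).ne'
    have h₂ := (Gamma_pos_of_pos ha).ne'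
    have h₃ := (rpow_pos_of_pos hr t).ne'
    rw [gammaPDFReal, gammaPDFReal, if_pos hx.le, if_pos hx.le, mul_comm t, ← rpow_def_of_pos hx,
      rpow_add hr, show a + t - 1 = (a - 1) + t by ring, rpow_add hx]
    field_simp

lemma integrable_exp_mul_log_gammaMeasure {a r t : ℝ} (ha : 0 < a) (hr : 0 < r)
    (hat : 0 < a + t) : Integrable (fun x ↦ exp (t * log x)) (gammaMeasure a r) := by
  rw [gammaMeasure, integrable_withDensity_iff_integrable_smul' (measurable_gammaPDF a r)
    (.of_forall fun _ ↦ ENNReal.ofReal_lt_top)]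
  refine ((integrable_gammaPDFReal hat hr).const_mul
    (Gamma (a + t) / (Gamma a * r ^ t))).congr ?_
  filter_upwards [Measure.ae_ne volume (0 : ℝ)] with x hx
  rw [toReal_gammaPDF ha hr, smul_eq_mul, gammaPDFReal_mul_exp_mul_log ha hr hat hx]

lemma mgf_log_gammaMeasure {a r t : ℝ} (ha : 0 < a) (hr : 0 < r) (hat : 0 < a + t) :
    mgf log (gammaMeasure a r) t = Gamma (a + t) / (Gamma a * r ^ t) := by
  rw [mgf, gammaMeasure, integral_withDensity_eq_integral_toReal_smul (measurable_gammaPDF a r)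
    (.of_forall fun _ ↦ ENNReal.ofReal_lt_top)]
  have h : (fun x ↦ (gammaPDF a r x).toReal • exp (t * log x)) =ᵐ[volume]
      fun x ↦ Gamma (a + t) / (Gamma a * r ^ t) * gammaPDFReal (a + t) r x := by
    filter_upwards [Measure.ae_ne volume (0 : ℝ)] with x hx
    rw [toReal_gammaPDF ha hr, smul_eq_mul, gammaPDFReal_mul_exp_mul_log ha hr hat hx]
  rw [integral_congr_ae h, integral_const_mul, integral_gammaPDFReal hat hr, mul_one]

lemma exp_one_mul_log_ae_eq_id (a r : ℝ) :
    (fun x ↦ exp (1 * log x)) =ᵐ[gammaMeasure a r] fun x ↦ x := by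
  filter_upwards [ae_pos_gammaMeasure a r] with x hx
  rw [one_mul, exp_log hx]

lemma integrable_id_gammaMeasure {a r : ℝ} (ha : 0 < a) (hr : 0 < r) :
    Integrable (fun x ↦ x) (gammaMeasure a r) :=
  (integrable_exp_mul_log_gammaMeasure ha hr (by positivity)).congr (exp_one_mul_log_ae_eq_id a r)

lemma integral_id_gammaMeasure {a r : ℝ} (ha : 0 < a) (hr : 0 < r) :
    ∫ x, x ∂gammaMeasure a r = a / r := by
  have h := mgf_log_gammaMeasure ha hr (t := 1) (by positivity)
  rw [mgf, integral_congr_ae (exp_one_mul_log_ae_eq_id a r), Gamma_add_one ha.ne', rpow_one] at h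
  rw [h, mul_comm a, mul_div_mul_left _ _ (Gamma_pos_of_pos ha).ne']

lemma zero_mem_interior_integrableExpSet_log_gammaMeasure {a r : ℝ} (ha : 0 < a) (hr : 0 < r) :
    0 ∈ interior (integrableExpSet log (gammaMeasure a r)) := by
  refine mem_interior.2 ⟨Set.Ioi (-a), fun t ht ↦ ?_, isOpen_Ioi, by simpa using ha⟩
  exact integrable_exp_mul_log_gammaMeasure ha hr (by linarith [Set.mem_Ioi.1 ht])

lemma integrable_log_gammaMeasure {a r : ℝ} (ha : 0 < a) (hr : 0 < r) :
    Integrable log (gammaMeasure a r) :=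
  integrable_of_mem_interior_integrableExpSet
    (zero_mem_interior_integrableExpSet_log_gammaMeasure ha hr)

lemma differentiableAt_log_Gamma {a : ℝ} (ha : 0 < a) :
    DifferentiableAt ℝ (fun x ↦ log (Gamma x)) a :=
  (differentiableAt_Gamma fun m ↦ by linarith [m.cast_nonneg (α := ℝ)]).log
    (Gamma_pos_of_pos ha).ne'

lemma integral_log_gammaMeasure {a r : ℝ} (ha : 0 < a) (hr : 0 < r) :
    ∫ x, log x ∂gammaMeasure a r = deriv (fun x ↦ log (Gamma x)) a - log r := by
  have := isProbabilityMeasure_gammaMeasure ha hr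
  have h := deriv_cgf_zero (zero_mem_interior_integrableExpSet_log_gammaMeasure ha hr)
  rw [probReal_univ, div_one] at h
  rw [← h]
  have hcgf : cgf log (gammaMeasure a r) =ᶠ[nhds 0]
      fun t ↦ log (Gamma (a + t)) - (log (Gamma a) + t * log r) := by
    filter_upwards [lt_mem_nhds (neg_neg_iff_pos.2 ha)] with t ht
    have hat : 0 < a + t := by linarith
    rw [cgf, mgf_log_gammaMeasure ha hr hat, log_div (Gamma_pos_of_pos hat).ne'
      (mul_pos (Gamma_pos_of_pos ha) (rpow_pos_of_pos hr t)).ne',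
      log_mul (Gamma_pos_of_pos ha).ne' (rpow_pos_of_pos hr t).ne', log_rpow hr]
  rw [hcgf.deriv_eq]
  have h₁ : HasDerivAt (fun t ↦ log (Gamma (a + t))) (deriv (fun x ↦ log (Gamma x)) a) 0 := by
    refine HasDerivAt.comp_const_add (f := fun x ↦ log (Gamma x)) a 0 ?_
    rw [add_zero]
    exact (differentiableAt_log_Gamma ha).hasDerivAt
  have h₂ : HasDerivAt (fun t ↦ log (Gamma a) + t * log r) (log r) 0 :=
    (hasDerivAt_mul_const (log r)).const_add _
  exact (h₁.sub h₂).deriv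

lemma gammaPDF_ne_zero {a r x : ℝ} (ha : 0 < a) (hr : 0 < r) (hx : 0 < x) :
    gammaPDF a r x ≠ 0 :=
  (ENNReal.ofReal_pos.2 (gammaPDFReal_pos ha hr hx)).ne'

lemma gammaMeasure_eq_withDensity_div {a₂ r₂ : ℝ} (a₁ r₁ : ℝ) (ha₂ : 0 < a₂) (hr₂ : 0 < r₂) :
    gammaMeasure a₁ r₁
      = (gammaMeasure a₂ r₂).withDensity (gammaPDF a₁ r₁ / gammaPDF a₂ r₂) := by
  rw [gammaMeasure, gammaMeasure, ← withDensity_mul _ (measurable_gammaPDF a₂ r₂)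
    ((measurable_gammaPDF a₁ r₁).div (measurable_gammaPDF a₂ r₂))]
  refine withDensity_congr_ae ?_
  filter_upwards [Measure.ae_ne volume (0 : ℝ)] with x hx
  rw [Pi.mul_apply, Pi.div_apply]
  rcases lt_or_gt_of_ne hx with hx | hx
  · simp [gammaPDF_of_neg hx]
  · exact (ENNReal.mul_div_cancel (gammaPDF_ne_zero ha₂ hr₂ hx) ENNReal.ofReal_ne_top).symm

lemma gammaMeasure_absolutelyContinuous {a₂ r₂ : ℝ} (a₁ r₁ : ℝ) (ha₂ : 0 < a₂) (hr₂ : 0 < r₂) :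
    gammaMeasure a₁ r₁ ≪ gammaMeasure a₂ r₂ := by
  rw [gammaMeasure_eq_withDensity_div a₁ r₁ ha₂ hr₂]
  exact withDensity_absolutelyContinuous _ _

lemma log_gammaPDFReal {a r x : ℝ} (ha : 0 < a) (hr : 0 < r) (hx : 0 < x) :
    log (gammaPDFReal a r x) = a * log r - log (Gamma a) + (a - 1) * log x - r * x := by
  have h₁ := (Gamma_pos_of_pos ha).ne'
  have h₂ := (rpow_pos_of_pos hr a).ne'
  have h₃ := (rpow_pos_of_pos hx (a - 1)).ne'
  rw [gammaPDFReal, if_pos hx.le, log_mul (by positivity) (exp_pos _).ne', log_exp,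
    log_mul (by positivity) h₃, log_div h₂ h₁, log_rpow hr, log_rpow hx]
  ring

lemma llr_gammaMeasure_gammaMeasure {a₁ a₂ r₁ r₂ : ℝ} (ha₁ : 0 < a₁) (ha₂ : 0 < a₂)
    (hr₁ : 0 < r₁) (hr₂ : 0 < r₂) :
    llr (gammaMeasure a₁ r₁) (gammaMeasure a₂ r₂) =ᵐ[gammaMeasure a₁ r₁] fun x ↦
      (a₁ * log r₁ - a₂ * log r₂ - log (Gamma a₁) + log (Gamma a₂))
        + ((a₁ - a₂) * log x + (r₂ - r₁) * x) := by
  have := isProbabilityMeasure_gammaMeasure ha₂ hr₂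
  have h := Measure.rnDeriv_withDensity (gammaMeasure a₂ r₂)
    ((measurable_gammaPDF a₁ r₁).div (measurable_gammaPDF a₂ r₂))
  rw [← gammaMeasure_eq_withDensity_div a₁ r₁ ha₂ hr₂] at h
  filter_upwards [(gammaMeasure_absolutelyContinuous a₁ r₁ ha₂ hr₂).ae_le h,
    ae_pos_gammaMeasure a₁ r₁] with x hx hpos
  rw [llr, hx, Pi.div_apply, ENNReal.toReal_div, toReal_gammaPDF ha₁ hr₁, toReal_gammaPDF ha₂ hr₂,
    log_div (gammaPDFReal_pos ha₁ hr₁ hpos).ne' (gammaPDFReal_pos ha₂ hr₂ hpos).ne',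
    log_gammaPDFReal ha₁ hr₁ hpos, log_gammaPDFReal ha₂ hr₂ hpos]
  ring

theorem klDiv_gammaMeasure_gammaMeasure
    (a₁ a₂ r₁ r₂ : ℝ) (ha₁ : 0 < a₁) (ha₂ : 0 < a₂) (hr₁ : 0 < r₁) (hr₂ : 0 < r₂) :
    klDiv (gammaMeasure a₁ r₁) (gammaMeasure a₂ r₂)
      = ENNReal.ofReal
          ((a₁ - a₂) * (deriv (fun x => Real.log (Real.Gamma x)) a₁)
            - Real.log (Real.Gamma a₁) + Real.log (Real.Gamma a₂)
            + a₂ * (Real.log r₁ - Real.log r₂) + a₁ * (r₂ - r₁) / r₁) := by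
  have := isProbabilityMeasure_gammaMeasure ha₁ hr₁
  have hllr := llr_gammaMeasure_gammaMeasure ha₁ ha₂ hr₁ hr₂
  have hlog := (integrable_log_gammaMeasure ha₁ hr₁).const_mul (a₁ - a₂)
  have hid := (integrable_id_gammaMeasure ha₁ hr₁).const_mul (r₂ - r₁)
  have hsum : Integrable (fun x ↦ (a₁ - a₂) * log x + (r₂ - r₁) * x) (gammaMeasure a₁ r₁) :=
    hlog.add hid
  rw [klDiv, if_pos ⟨gammaMeasure_absolutelyContinuous a₁ r₁ ha₂ hr₂,
    ((integrable_const _).add hsum).congr hllr.symm⟩, integral_congr_ae hllr,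
    integral_add (integrable_const _) hsum, integral_add hlog hid, integral_const_mul,
    integral_const_mul, integral_log_gammaMeasure ha₁ hr₁, integral_id_gammaMeasure ha₁ hr₁,
    integral_const, probReal_univ, one_smul]
  congr 1
  ring
end
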